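/- arXiv:2001.05589 — 3 statements merged into one kernel-verified Lean document; each statement's English description precedes it below -/
import Mathlib

section
/- For every ε with 0 < ε < 2, the proportion, among all n! permutations π of [n], of those containing a pair of block twins of length ⌊(2 − ε)·log n / log log n⌋ tends to 1 as n → ∞. Together with the matching upper bound, a uniformly random n-permutation asymptotically almost surely satisfies bt(π) = (2 + o(1))·log n / log log n. -/
/-- `f` and `g` enumerate (in increasing order of positions) a pair of twins in the
permutation `π`: both are strictly monotone position sequences, with disjoint ranges,
and the two subsequences of `π` are order-isomorphic. -/
def IsTwinPair {n : ℕ} (π : Equiv.Perm (Fin n)) {k : ℕ} (f g : Fin k → Fin n) : Prop :=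
  StrictMono f ∧ StrictMono g ∧ (∀ a b : Fin k, f a ≠ g b) ∧
    (∀ a b : Fin k, π (f a) < π (f b) ↔ π (g a) < π (g b))

/-- `π` contains a pair of twins of length `k`. -/
def HasTwins {n : ℕ} (π : Equiv.Perm (Fin n)) (k : ℕ) : Prop :=
  ∃ f g : Fin k → Fin n, IsTwinPair π f g

/-- `t(π)`: the maximum length of a pair of twins in `π`. -/
noncomputable def twinLen {n : ℕ} (π : Equiv.Perm (Fin n)) : ℕ :=
  sSup {k | HasTwins π k}

/-- The range of `f` is a block (a set of consecutive positions). -/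
def IsBlockFun {n k : ℕ} (f : Fin k → Fin n) : Prop :=
  ∃ s : ℕ, ∀ a : Fin k, (f a : ℕ) = s + (a : ℕ)

/-- `π` contains a pair of block twins of length `k`. -/
def HasBlockTwins {n : ℕ} (π : Equiv.Perm (Fin n)) (k : ℕ) : Prop :=
  ∃ f g : Fin k → Fin n, IsTwinPair π f g ∧ IsBlockFun f ∧ IsBlockFun g

/-- The union of the ranges of `f` and `g` is a block (a set of `2k` consecutive positions). -/
def IsTightPair {n k : ℕ} (f g : Fin k → Fin n) : Prop :=
  ∃ s : ℕ, ∀ x : Fin n,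
    ((∃ a, f a = x) ∨ (∃ a, g a = x)) ↔ (s ≤ (x : ℕ) ∧ (x : ℕ) < s + 2 * k)

/-- `π` contains a pair of tight twins of length `k`. -/
def HasTightTwins {n : ℕ} (π : Equiv.Perm (Fin n)) (k : ℕ) : Prop :=
  ∃ f g : Fin k → Fin n, IsTwinPair π f g ∧ IsTightPair f g

open Finset Filter Topology

/-- The embedding of `m` consecutive blocks of `k` positions each into `Fin n`. -/
def blockEmbedding {m k n : ℕ} (h : m * k ≤ n) : Fin m × Fin k ↪ Fin n :=
  finProdFinEquiv.toEmbedding.trans (Fin.castLEEmb h)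

lemma blockEmbedding_val {m k n : ℕ} (h : m * k ≤ n) (j : Fin m) (a : Fin k) :
    (blockEmbedding h (j, a) : ℕ) = k * j + a := by
  simp [blockEmbedding, finProdFinEquiv, add_comm]

/-- The permutation of `Fin n` that permutes the positions inside the `j`-th block by `g j`. -/
noncomputable def blockPerm {m k n : ℕ} (h : m * k ≤ n) (g : Fin m → Equiv.Perm (Fin k)) :
    Equiv.Perm (Fin n) :=
  Equiv.Perm.viaEmbedding (Equiv.prodCongrRight g) (blockEmbedding h)

lemma blockPerm_apply {m k n : ℕ} (h : m * k ≤ n) (g : Fin m → Equiv.Perm (Fin k))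
    (j : Fin m) (a : Fin k) :
    blockPerm h g (blockEmbedding h (j, a)) = blockEmbedding h (j, g j a) := by
  simp [blockPerm, Equiv.Perm.viaEmbedding_apply]

/-- Two blocks with the same pattern form a pair of block twins. -/
lemma hasBlockTwins_of_same_pattern {m k n : ℕ} (h : m * k ≤ n) (π : Equiv.Perm (Fin n))
    {i j : Fin m} (hij : i ≠ j)
    (hπ : ∀ a b : Fin k, π (blockEmbedding h (i, a)) < π (blockEmbedding h (i, b)) ↔
      π (blockEmbedding h (j, a)) < π (blockEmbedding h (j, b))) :
    HasBlockTwins π k := by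
  refine ⟨fun a => blockEmbedding h (i, a), fun a => blockEmbedding h (j, a),
    ⟨?_, ?_, ?_, hπ⟩, ⟨k * i, fun a => blockEmbedding_val h i a⟩,
    ⟨k * j, fun a => blockEmbedding_val h j a⟩⟩
  · intro a b hab
    change (blockEmbedding h (i, a) : ℕ) < blockEmbedding h (i, b)
    rw [blockEmbedding_val, blockEmbedding_val]
    exact Nat.add_lt_add_left hab _
  · intro a b hab
    change (blockEmbedding h (j, a) : ℕ) < blockEmbedding h (j, b)
    rw [blockEmbedding_val, blockEmbedding_val]
    exact Nat.add_lt_add_left hab _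
  · intro a b hab
    exact hij (congrArg Prod.fst ((blockEmbedding h).injective hab))

/-- Sorting permutations of the blocks turn a within-block shuffle of a permutation without block
twins into an injective family of patterns. -/
lemma exists_injective_patterns {m k n : ℕ} (h : m * k ≤ n) (π : Equiv.Perm (Fin n)) :
    ∃ σ : Fin m → Equiv.Perm (Fin k), ∀ g : Fin m → Equiv.Perm (Fin k),
      ¬ HasBlockTwins (π * blockPerm h g) k → Function.Injective (σ * g) := by
  let u : Fin m → Fin k → Fin n := fun j a => π (blockEmbedding h (j, a))
  have hu : ∀ j, Function.Injective (u j) := fun j a b hab =>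
    congrArg Prod.snd ((blockEmbedding h).injective (π.injective hab))
  have hs : ∀ j, StrictMono (u j ∘ Tuple.sort (u j)) := fun j =>
    (Tuple.monotone_sort (u j)).strictMono_of_injective
      ((hu j).comp (Tuple.sort (u j)).injective)
  refine ⟨fun j => (Tuple.sort (u j))⁻¹, fun g hg i j hij => ?_⟩
  by_contra hne
  refine hg (hasBlockTwins_of_same_pattern h _ hne fun a b => ?_)
  have key : ∀ (l : Fin m) (a b : Fin k),
      (π * blockPerm h g) (blockEmbedding h (l, a)) < (π * blockPerm h g) (blockEmbedding h (l, b))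
        ↔ ((Tuple.sort (u l))⁻¹ * g l) a < ((Tuple.sort (u l))⁻¹ * g l) b := by
    intro l a b
    rw [← (hs l).lt_iff_lt]
    simp [u, blockPerm_apply]
  have hij' : (Tuple.sort (u i))⁻¹ * g i = (Tuple.sort (u j))⁻¹ * g j := hij
  rw [key, key, hij']

lemma card_injective_patterns (m k : ℕ) :
    Nat.card {g : Fin m → Equiv.Perm (Fin k) // Function.Injective g}
      = (k.factorial).descFactorial m := by
  rw [Nat.card_congr (Equiv.subtypeInjectiveEquivEmbedding _ _), Nat.card_eq_fintype_card,
    Fintype.card_embedding_eq, Fintype.card_perm, Fintype.card_fin, Fintype.card_fin]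

/-- Averaging over within-block shuffles bounds the number of permutations without block twins. -/
lemma card_not_hasBlockTwins_mul_le {m k n : ℕ} (h : m * k ≤ n) :
    Nat.card {π : Equiv.Perm (Fin n) // ¬ HasBlockTwins π k} * k.factorial ^ m
      ≤ n.factorial * (k.factorial).descFactorial m := by
  classical
  let G := Fin m → Equiv.Perm (Fin k)
  have hG : Fintype.card G = k.factorial ^ m := by
    simp [G, Fintype.card_perm]
  have hB : ∀ g : G,
      (univ.filter fun π : Equiv.Perm (Fin n) => ¬ HasBlockTwins (π * blockPerm h g) k).card
        = Nat.card {π : Equiv.Perm (Fin n) // ¬ HasBlockTwins π k} := by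
    intro g
    rw [← Fintype.card_subtype, ← Nat.card_eq_fintype_card]
    exact Nat.card_congr ((Equiv.mulRight (blockPerm h g)).subtypeEquiv fun _ => Iff.rfl)
  have hI : ∀ π : Equiv.Perm (Fin n),
      (univ.filter fun g : G => ¬ HasBlockTwins (π * blockPerm h g) k).card
        ≤ (k.factorial).descFactorial m := by
    intro π
    obtain ⟨σ, hσ⟩ := exists_injective_patterns h π
    rw [← card_injective_patterns, Nat.card_eq_fintype_card, Fintype.card_subtype]
    refine Finset.card_le_card_of_injOn (fun g => σ * g) (fun g hg => ?_)
      (fun a _ b _ hab => mul_left_cancel hab)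
    simp only [coe_filter, mem_univ, true_and, Set.mem_ofPred_eq] at hg ⊢
    exact hσ g hg
  calc Nat.card {π : Equiv.Perm (Fin n) // ¬ HasBlockTwins π k} * k.factorial ^ m
      = ∑ g : G, (univ.filter fun π : Equiv.Perm (Fin n) =>
          ¬ HasBlockTwins (π * blockPerm h g) k).card := by
        rw [Finset.sum_congr rfl fun g _ => hB g, Finset.sum_const, Finset.card_univ, hG,
          smul_eq_mul, mul_comm]
    _ = ∑ π : Equiv.Perm (Fin n), (univ.filter fun g : G =>
          ¬ HasBlockTwins (π * blockPerm h g) k).card := by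
        simp only [Finset.card_filter]
        exact Finset.sum_comm
    _ ≤ ∑ _π : Equiv.Perm (Fin n), (k.factorial).descFactorial m :=
        Finset.sum_le_sum fun π _ => hI π
    _ = n.factorial * (k.factorial).descFactorial m := by
        simp [Fintype.card_perm]

/-- The birthday bound. -/
lemma descFactorial_le_pow_mul_exp {N : ℕ} (hN : 0 < N) (m : ℕ) :
    (N.descFactorial m : ℝ) ≤ (N : ℝ) ^ m * Real.exp (-((m : ℝ) * (m - 1) / (2 * N))) := by
  have hN' : (0 : ℝ) < N := by exact_mod_cast hN
  induction m with
  | zero => simp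
  | succ m ih =>
    have h1 : ((N - m : ℕ) : ℝ) ≤ N * Real.exp (-(m / N : ℝ)) := by
      rcases le_total m N with hm | hm
      · rw [Nat.cast_sub hm]
        have := Real.add_one_le_exp (-(m / N : ℝ))
        calc (N : ℝ) - m = N * (-(m / N : ℝ) + 1) := by field_simp; ring
          _ ≤ _ := by gcongr
      · rw [Nat.sub_eq_zero_of_le hm]
        simp only [Nat.cast_zero]
        positivity
    rw [Nat.descFactorial_succ, Nat.cast_mul]
    calc ((N - m : ℕ) : ℝ) * (N.descFactorial m : ℝ)
        ≤ (N * Real.exp (-(m / N : ℝ))) *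
          ((N : ℝ) ^ m * Real.exp (-((m : ℝ) * (m - 1) / (2 * N)))) := by gcongr
      _ = (N : ℝ) ^ (m + 1) *
          (Real.exp (-(m / N : ℝ)) * Real.exp (-((m : ℝ) * (m - 1) / (2 * N)))) := by ring
      _ = _ := by
        rw [← Real.exp_add]
        congr 2
        push_cast
        field_simp
        ring

lemma one_sub_exp_le_proportion_hasBlockTwins {m k n : ℕ} (h : m * k ≤ n) :
    1 - Real.exp (-((m : ℝ) * (m - 1) / (2 * k.factorial)))
      ≤ (Nat.card {π : Equiv.Perm (Fin n) // HasBlockTwins π k} : ℝ) / (n.factorial : ℝ) := by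
  classical
  have hk : (0 : ℝ) < k.factorial := by exact_mod_cast k.factorial_pos
  have hn : (0 : ℝ) < n.factorial := by exact_mod_cast n.factorial_pos
  have hsum : (Nat.card {π : Equiv.Perm (Fin n) // HasBlockTwins π k} : ℝ)
      + (Nat.card {π : Equiv.Perm (Fin n) // ¬ HasBlockTwins π k} : ℝ) = n.factorial := by
    have := Fintype.card_subtype_compl (fun π : Equiv.Perm (Fin n) => HasBlockTwins π k)
    have hle := Fintype.card_subtype_le (fun π : Equiv.Perm (Fin n) => HasBlockTwins π k)
    rw [Fintype.card_perm, Fintype.card_fin] at this hle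
    rw [Nat.card_eq_fintype_card, Nat.card_eq_fintype_card]
    norm_cast
    omega
  have hbad : (Nat.card {π : Equiv.Perm (Fin n) // ¬ HasBlockTwins π k} : ℝ)
      ≤ n.factorial * Real.exp (-((m : ℝ) * (m - 1) / (2 * k.factorial))) := by
    have h1 : (Nat.card {π : Equiv.Perm (Fin n) // ¬ HasBlockTwins π k} : ℝ)
        * (k.factorial : ℝ) ^ m ≤ n.factorial * ((k.factorial).descFactorial m : ℝ) := by
      exact_mod_cast card_not_hasBlockTwins_mul_le h
    have h2 := mul_le_mul_of_nonneg_left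
      (descFactorial_le_pow_mul_exp k.factorial_pos m) hn.le
    refine le_of_mul_le_mul_right (h1.trans (h2.trans_eq ?_)) (pow_pos hk m)
    ring
  rw [le_div_iff₀ hn]
  linarith

lemma factorial_floor_le_rpow {ε x : ℝ} (hε : 0 < ε) (hε2 : ε < 2) (hx : 0 < x)
    (hL : 2 ≤ Real.log (Real.log x)) (hL0 : 0 < Real.log x) :
    (⌊(2 - ε) * Real.log x / Real.log (Real.log x)⌋₊ : ℝ) ≤ Real.log x ∧
    ((⌊(2 - ε) * Real.log x / Real.log (Real.log x)⌋₊.factorial : ℕ) : ℝ) ≤ x ^ (2 - ε) := by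
  set L := Real.log x with hLdef
  set k := ⌊(2 - ε) * L / Real.log L⌋₊ with hk
  have hll : 0 < Real.log L := by linarith
  have hk1 : (k : ℝ) ≤ (2 - ε) * L / Real.log L :=
    Nat.floor_le (div_nonneg (mul_nonneg (by linarith) hL0.le) hll.le)
  have hkL : (k : ℝ) ≤ L := by
    refine hk1.trans ?_
    rw [div_le_iff₀ hll]
    nlinarith
  refine ⟨hkL, ?_⟩
  calc (k.factorial : ℝ) ≤ (k : ℝ) ^ k := by exact_mod_cast k.factorial_le_pow
    _ ≤ L ^ k := by gcongr
    _ = Real.exp (Real.log L * k) := by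
      rw [← Real.rpow_natCast, Real.rpow_def_of_pos hL0]
    _ ≤ Real.exp (L * (2 - ε)) := by
      rw [le_div_iff₀ hll] at hk1
      exact Real.exp_le_exp.mpr (by linarith)
    _ = x ^ (2 - ε) := by rw [Real.rpow_def_of_pos hx]

lemma tendsto_rpow_div_log_sq {ε : ℝ} (hε : 0 < ε) :
    Tendsto (fun x : ℝ => x ^ ε / (8 * Real.log x ^ 2)) atTop atTop := by
  have h1 : Tendsto (fun x : ℝ => Real.log x ^ (2 : ℝ) / x ^ ε) atTop (𝓝 0) :=
    (isLittleO_log_rpow_rpow_atTop 2 hε).tendsto_div_nhds_zero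
  have h2 : Tendsto (fun x : ℝ => Real.log x ^ (2 : ℝ) / x ^ ε) atTop (𝓝[>] 0) := by
    refine tendsto_nhdsWithin_iff.mpr ⟨h1, ?_⟩
    filter_upwards [eventually_gt_atTop 1] with x hx
    have := Real.log_pos hx
    have : 0 < x := by linarith
    simp only [Set.mem_Ioi]
    positivity
  refine ((h2.inv_tendsto_nhdsGT_zero).const_mul_atTop (by norm_num : (0 : ℝ) < 1 / 8)).congr
    fun x => ?_
  simp only [Pi.inv_apply, inv_div, Real.rpow_two]
  ring

/-- For every $0 < ε < 2$, the proportion of $n$-permutations containing a pair of block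
twins of length $⌊(2−ε)\log n/\log\log n⌋$ tends to $1$ (so a.a.s.
$bt(Π_n) = (2+o(1))\log n/\log\log n$). -/
theorem random_block_twins_lower (ε : ℝ) (hε : 0 < ε) (hε2 : ε < 2) :
    Filter.Tendsto (fun n : ℕ =>
        (Nat.card {π : Equiv.Perm (Fin n) //
            HasBlockTwins π ⌊(2 - ε) * Real.log n / Real.log (Real.log n)⌋₊} : ℝ)
          / (Nat.factorial n : ℝ))
      Filter.atTop (nhds 1) := by
  have hlim : Tendsto (fun n : ℕ => 1 - Real.exp (-((n : ℝ) ^ ε / (8 * Real.log n ^ 2))))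
      atTop (𝓝 1) := by
    have := (Real.tendsto_exp_neg_atTop_nhds_zero.comp
      ((tendsto_rpow_div_log_sq hε).comp tendsto_natCast_atTop_atTop)).const_sub (1 : ℝ)
    simpa [Function.comp_def] using this
  have hlog : Tendsto (fun n : ℕ => Real.log n) atTop atTop :=
    Real.tendsto_log_atTop.comp tendsto_natCast_atTop_atTop
  have hsmall : ∀ᶠ n : ℕ in atTop, 4 * Real.log n ≤ n := by
    have := tendsto_natCast_atTop_atTop.eventually
      (Real.isLittleO_log_id_atTop.bound (by norm_num : (0 : ℝ) < 1 / 4))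
    filter_upwards [this] with n hn
    simp only [Real.norm_eq_abs, id_eq, Nat.abs_cast] at hn
    linarith [le_abs_self (Real.log n)]
  refine tendsto_of_tendsto_of_tendsto_of_le_of_le' hlim tendsto_const_nhds ?_ ?_
  · filter_upwards [hsmall, (Real.tendsto_log_atTop.comp hlog).eventually_ge_atTop 2,
      hlog.eventually_gt_atTop 0, eventually_gt_atTop 0] with n h4 hll hL hn
    have hn' : (0 : ℝ) < n := by exact_mod_cast hn
    obtain ⟨hkL, hkf⟩ := factorial_floor_le_rpow hε hε2 hn' hll hL
    set k := ⌊(2 - ε) * Real.log n / Real.log (Real.log n)⌋₊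
    set L := Real.log (n : ℝ)
    set m := ⌊(n : ℝ) / L⌋₊
    have hm1 : (m : ℝ) ≤ n / L := Nat.floor_le (by positivity)
    have hm2 : (n : ℝ) / L < m + 1 := Nat.lt_floor_add_one _
    have hmk : m * k ≤ n := by
      have : (m : ℝ) * k ≤ n := by
        calc (m : ℝ) * k ≤ n / L * L := by gcongr
          _ = n := by field_simp
      exact_mod_cast this
    refine le_trans ?_ (one_sub_exp_le_proportion_hasBlockTwins hmk)
    refine sub_le_sub_left (Real.exp_le_exp.mpr (neg_le_neg ?_)) 1
    have hq : 4 ≤ (n : ℝ) / L := by rwa [le_div_iff₀ hL]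
    have hmm : ((n : ℝ) / L) ^ 2 / 4 ≤ m * (m - 1) := by nlinarith
    have hkpos : (0 : ℝ) < k.factorial := by exact_mod_cast k.factorial_pos
    calc (n : ℝ) ^ ε / (8 * L ^ 2) = ((n : ℝ) / L) ^ 2 / 4 / (2 * (n : ℝ) ^ (2 - ε)) := by
          rw [Real.rpow_sub hn', Real.rpow_two]
          have : (0 : ℝ) < (n : ℝ) ^ ε := by positivity
          field_simp
          norm_num
      _ ≤ ((n : ℝ) / L) ^ 2 / 4 / (2 * k.factorial) := by gcongr
      _ ≤ m * (m - 1) / (2 * k.factorial) := by gcongr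
  · refine Eventually.of_forall fun n => ?_
    refine div_le_one_of_le₀ ?_ (Nat.cast_nonneg _)
    have := Nat.card_le_card_of_injective _ (Subtype.val_injective
      (p := fun π : Equiv.Perm (Fin n) =>
        HasBlockTwins π ⌊(2 - ε) * Real.log n / Real.log (Real.log n)⌋₊))
    rw [Nat.card_eq_fintype_card (α := Equiv.Perm (Fin n)), Fintype.card_perm,
      Fintype.card_fin] at this
    exact_mod_cast this
end

section
/- For every n ≥ 1 there exists a permutation π of [n] containing no pair of tight twins of length k for any k ≥ 13; in particular tt(n) ≤ 12 for all n ≥ 1. -/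
/-- $tt(π)$: the maximum length of a pair of tight twins in $π$. -/
noncomputable def ttPerm {n : ℕ} (π : Equiv.Perm (Fin n)) : ℕ :=
  sSup {k | HasTightTwins π k}

/-- $tt(n)$: the minimum of $tt(π)$ over all permutations of $[n]$. -/
noncomputable def tt (n : ℕ) : ℕ :=
  sInf (Set.range fun π : Equiv.Perm (Fin n) => ttPerm π)

/-- Every pair of tight twins of length at least `13` in `π` uses a position that is at least `j`. -/
def TightTwinFreeBelow {n : ℕ} (π : Equiv.Perm (Fin n)) (j : ℕ) : Prop :=
  ∀ k, 13 ≤ k → ∀ f g : Fin k → Fin n, IsTwinPair π f g → IsTightPair f g →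
    ∃ a, j ≤ (f a : ℕ) ∨ j ≤ (g a : ℕ)

theorem TightTwinFreeBelow.congr {n j : ℕ} {π ρ : Equiv.Perm (Fin n)}
    (h : TightTwinFreeBelow π j) (hπρ : ∀ x : Fin n, (x : ℕ) < j → ρ x = π x) :
    TightTwinFreeBelow ρ j := by
  intro k hk f g hfg ht
  by_contra! hlt
  obtain ⟨hf, hg, hd, ho⟩ := hfg
  obtain ⟨a, ha⟩ := h k hk f g ⟨hf, hg, hd, fun a b => by
    rw [← hπρ _ (hlt a).1, ← hπρ _ (hlt b).1, ← hπρ _ (hlt a).2, ← hπρ _ (hlt b).2]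
    exact ho a b⟩ ht
  have := hlt a
  omega

/-- A permutation of the index set preserving the relative order of an injective sequence is
trivial. -/
theorem perm_eq_one_of_forall_lt_iff {ι α : Type*} [Finite ι] [LinearOrder α] {h : ι → α}
    (hh : Function.Injective h) {τ : Equiv.Perm ι}
    (hτ : ∀ a b, h a < h b ↔ h (τ a) < h (τ b)) : τ = 1 := by
  have iter : ∀ (l : ℕ) a b, h a < h b ↔ h ((τ ^ l) a) < h ((τ ^ l) b) := by
    intro l
    induction l with
    | zero => simp
    | succ l ih =>
      intro a b
      rw [hτ a b, ih, pow_succ]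
      rfl
  ext a
  by_contra hne
  have hinj : Function.Injective fun l : ℕ => h ((τ ^ l) a) := by
    rcases lt_or_gt_of_ne (fun he => hne (hh he) : h (τ a) ≠ h a) with hlt | hlt
    · refine (strictAnti_nat_of_succ_lt fun l => ?_).injective
      rw [pow_succ]
      exact (iter l _ _).1 hlt
    · refine (strictMono_nat_of_lt_succ fun l => ?_).injective
      rw [pow_succ]
      exact (iter l _ _).1 hlt
  exact not_injective_infinite_finite (fun l : ℕ => (τ ^ l) a)
    fun x y hxy => hinj (congrArg h hxy)

open Classical in
/-- The permutations without long tight twins below position `j`. -/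
noncomputable def goodPerms (n j : ℕ) : Finset (Equiv.Perm (Fin n)) :=
  Finset.univ.filter fun π => TightTwinFreeBelow π j

theorem mem_goodPerms {n j : ℕ} {π : Equiv.Perm (Fin n)} :
    π ∈ goodPerms n j ↔ TightTwinFreeBelow π j := by
  simp [goodPerms]

open Classical in
/-- Permuting the values at the positions `g` shows that `(f, g)` is a pair of twins in at most a
proportion `1 / k!` of the good permutations. -/
theorem factorial_mul_card_twins_le {n k m : ℕ} {f g : Fin k → Fin n} (hg : StrictMono g)
    (hd : ∀ a b, f a ≠ g b) (hm : ∀ a, m ≤ (g a : ℕ)) :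
    k.factorial * ((goodPerms n m).filter fun π => IsTwinPair π f g).card
      ≤ (goodPerms n m).card := by
  let ι : Fin k ↪ Fin n := ⟨g, hg.injective⟩
  have hι : ∀ a, ι a = g a := fun _ => rfl
  have hf : ∀ (σ : Equiv.Perm (Fin k)) a, σ.viaEmbedding ι (f a) = f a := fun σ a =>
    Equiv.Perm.viaEmbedding_apply_of_notMem _ _ _ (by
      rintro ⟨b, hb⟩
      exact hd a b hb.symm)
  have hperm : k.factorial = (Finset.univ : Finset (Equiv.Perm (Fin k))).card := by
    rw [Finset.card_univ, Fintype.card_perm, Fintype.card_fin]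
  rw [hperm, ← Finset.card_product]
  refine Finset.card_le_card_of_injOn
    (fun p => p.2 * Equiv.Perm.viaEmbedding p.1 ι) ?_ ?_
  · rintro ⟨σ, π⟩ hp
    simp only [Finset.coe_product, Set.mem_prod, Finset.mem_coe, Finset.mem_filter,
      mem_goodPerms] at hp ⊢
    refine hp.2.1.congr fun x hx => ?_
    rw [Equiv.Perm.mul_apply, Equiv.Perm.viaEmbedding_apply_of_notMem]
    rintro ⟨b, rfl⟩
    exact absurd (hm b) (not_le.2 hx)
  · rintro ⟨σ, π⟩ hp ⟨σ', π'⟩ hp' heq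
    simp only [Finset.coe_product, Set.mem_prod, Finset.mem_coe, Finset.mem_filter,
      mem_goodPerms] at hp hp'
    have heq' : π * σ.viaEmbedding ι = π' * σ'.viaEmbedding ι := heq
    have hπf : ∀ a, π (f a) = π' (f a) := fun a => by
      have := DFunLike.congr_fun heq' (f a)
      simpa only [Equiv.Perm.mul_apply, hf] using this
    have hπg : ∀ a, π (g ((σ * σ'⁻¹) a)) = π' (g a) := fun a => by
      have := DFunLike.congr_fun heq' (g (σ'⁻¹ a))
      simp only [Equiv.Perm.mul_apply, ← hι, Equiv.Perm.viaEmbedding_apply] at this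
      simpa [hι] using this
    have hone : σ * σ'⁻¹ = 1 :=
      perm_eq_one_of_forall_lt_iff (h := fun a => π (g a))
        (π.injective.comp hg.injective) fun a b => by
          simp only [hπg]
          rw [← hp.2.2.2.2.2, ← hp'.2.2.2.2.2, hπf, hπf]
    have hσ : σ = σ' := mul_inv_eq_one.1 hone
    subst hσ
    rw [mul_left_injective _ heq']

open Classical in
/-- The pairs of increasing position sequences that partition the block `[m, m + 2k)`. -/
noncomputable def tightPairs (n k m : ℕ) : Finset ((Fin k → Fin n) × (Fin k → Fin n)) :=
  Finset.univ.filter fun p => StrictMono p.1 ∧ StrictMono p.2 ∧ (∀ a b, p.1 a ≠ p.2 b) ∧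
    ∀ x : Fin n, ((∃ a, p.1 a = x) ∨ (∃ a, p.2 a = x)) ↔ (m ≤ (x : ℕ) ∧ (x : ℕ) < m + 2 * k)

theorem mem_tightPairs {n k m : ℕ} {p : (Fin k → Fin n) × (Fin k → Fin n)} :
    p ∈ tightPairs n k m ↔ StrictMono p.1 ∧ StrictMono p.2 ∧ (∀ a b, p.1 a ≠ p.2 b) ∧
      ∀ x : Fin n, ((∃ a, p.1 a = x) ∨ (∃ a, p.2 a = x)) ↔
        (m ≤ (x : ℕ) ∧ (x : ℕ) < m + 2 * k) := by
  simp [tightPairs]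

theorem card_tightPairs_le (n k m : ℕ) : (tightPairs n k m).card ≤ k.centralBinom := by
  have hcard : (Finset.powersetCard k (Finset.Ico m (m + 2 * k))).card = k.centralBinom := by
    rw [Finset.card_powersetCard, Nat.card_Ico, Nat.add_sub_cancel_left, Nat.centralBinom]
  rw [← hcard]
  refine Finset.card_le_card_of_injOn
    (fun p => Finset.univ.image fun a => (p.1 a : ℕ)) ?_ ?_
  · intro p hp
    obtain ⟨hf, -, -, hb⟩ := mem_tightPairs.1 hp
    rw [Finset.mem_coe, Finset.mem_powersetCard]
    constructor
    · intro x hx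
      obtain ⟨a, -, rfl⟩ := Finset.mem_image.1 hx
      exact Finset.mem_Ico.2 ((hb _).1 (Or.inl ⟨a, rfl⟩))
    · refine (Finset.card_image_of_injective _ (Fin.val_injective.comp hf.injective)).trans ?_
      simp
  · rintro ⟨f, g⟩ hp ⟨f', g'⟩ hp' heq
    obtain ⟨hf, hg, hd, hb⟩ := mem_tightPairs.1 hp
    obtain ⟨hf', hg', hd', hb'⟩ := mem_tightPairs.1 hp'
    simp only at hf hg hd hb hf' hg' hd' hb' heq
    have hff : ∀ x, (∃ a, f a = x) ↔ ∃ a, f' a = x := fun x => by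
      have := Finset.ext_iff.1 heq x
      simpa [Fin.val_inj] using this
    have hgg : ∀ x, (∃ a, g a = x) ↔ ∃ a, g' a = x := fun x => by
      have h₁ := hff x
      have h₂ := hb x
      have h₃ := hb' x
      have h₄ : ¬((∃ a, f a = x) ∧ ∃ a, g a = x) := by
        rintro ⟨⟨a, ha⟩, b, hb⟩
        exact hd a b (ha.trans hb.symm)
      have h₅ : ¬((∃ a, f' a = x) ∧ ∃ a, g' a = x) := by
        rintro ⟨⟨a, ha⟩, b, hb⟩
        exact hd' a b (ha.trans hb.symm)
      exact ⟨fun h => ((h₃.2 (h₂.1 (Or.inr h))).resolve_left fun hx => h₄ ⟨h₁.2 hx, h⟩),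
        fun h => ((h₂.2 (h₃.1 (Or.inr h))).resolve_left fun hx => h₅ ⟨h₁.1 hx, h⟩)⟩
    exact Prod.ext ((hf.range_inj hf').1 (Set.ext hff)) ((hg.range_inj hg').1 (Set.ext hgg))

/-- A tight pair that first appears when position `j` is added occupies the block ending at `j`. -/
theorem exists_mem_tightPairs {n k j : ℕ} {f g : Fin k → Fin n} (hf : StrictMono f)
    (hg : StrictMono g) (hd : ∀ a b, f a ≠ g b) (ht : IsTightPair f g)
    (hlt : ∀ a, (f a : ℕ) < j + 1 ∧ (g a : ℕ) < j + 1)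
    (hj : ∃ a, j ≤ (f a : ℕ) ∨ j ≤ (g a : ℕ)) :
    2 * k ≤ j + 1 ∧ (f, g) ∈ tightPairs n k (j + 1 - 2 * k) := by
  classical
  obtain ⟨s, hs⟩ := ht
  have hjs : j < s + 2 * k := by
    obtain ⟨a, ha⟩ := hj
    have h₁ := (hs _).1 (Or.inl ⟨a, rfl⟩)
    have h₂ := (hs _).1 (Or.inr ⟨a, rfl⟩)
    omega
  have hcard : (Finset.univ.image (fun a => (f a : ℕ)) ∪
      Finset.univ.image (fun a => (g a : ℕ))).card = 2 * k := by
    have hfi : Function.Injective fun a => (f a : ℕ) := Fin.val_injective.comp hf.injective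
    have hgi : Function.Injective fun a => (g a : ℕ) := Fin.val_injective.comp hg.injective
    rw [Finset.card_union_of_disjoint, Finset.card_image_of_injective _ hfi,
      Finset.card_image_of_injective _ hgi]
    · simp [two_mul]
    · rw [Finset.disjoint_left]
      intro x hx hy
      obtain ⟨a, -, rfl⟩ := Finset.mem_image.1 hx
      obtain ⟨b, -, hb⟩ := Finset.mem_image.1 hy
      exact hd a b (Fin.val_injective hb.symm)
  have hle : 2 * k ≤ j + 1 - s := by
    rw [← hcard, ← Nat.card_Ico]
    refine Finset.card_le_card fun x hx => ?_
    rw [Finset.mem_Ico]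
    rcases Finset.mem_union.1 hx with hx | hx <;> obtain ⟨a, -, rfl⟩ := Finset.mem_image.1 hx
    · exact ⟨((hs _).1 (Or.inl ⟨a, rfl⟩)).1, (hlt a).1⟩
    · exact ⟨((hs _).1 (Or.inr ⟨a, rfl⟩)).1, (hlt a).2⟩
  obtain ⟨a, -⟩ := hj
  have hk := a.pos
  obtain rfl : s = j + 1 - 2 * k := by omega
  exact ⟨by omega, mem_tightPairs.2 ⟨hf, hg, hd, hs⟩⟩

open Classical in
/-- Union bound for the permutations that stop being good when position `j` is added. -/
theorem card_goodPerms_le_add_sum (n j : ℕ) :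
    (goodPerms n j).card ≤ (goodPerms n (j + 1)).card +
      ∑ k ∈ (Finset.Ico 13 (j + 2)).filter (fun k => 2 * k ≤ j + 1),
        ∑ p ∈ tightPairs n k (j + 1 - 2 * k),
          ((goodPerms n (j + 1 - 2 * k)).filter fun π => IsTwinPair π p.1 p.2).card := by
  refine le_trans (Finset.card_le_card (t := goodPerms n (j + 1) ∪
    ((Finset.Ico 13 (j + 2)).filter (fun k => 2 * k ≤ j + 1)).biUnion fun k =>
      (tightPairs n k (j + 1 - 2 * k)).biUnion fun p =>
        (goodPerms n (j + 1 - 2 * k)).filter fun π => IsTwinPair π p.1 p.2) ?_) ?_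
  · intro π hπ
    rw [Finset.mem_union, or_iff_not_imp_left]
    intro hπ'
    rw [mem_goodPerms] at hπ hπ'
    unfold TightTwinFreeBelow at hπ'
    push Not at hπ'
    obtain ⟨k, hk, f, g, hfg, ht, hlt⟩ := hπ'
    obtain ⟨hkj, hmem⟩ := exists_mem_tightPairs hfg.1 hfg.2.1 hfg.2.2.1 ht hlt
      (hπ k hk f g hfg ht)
    simp only [Finset.mem_biUnion, Finset.mem_filter, Finset.mem_Ico, mem_goodPerms]
    refine ⟨k, ⟨⟨hk, by omega⟩, hkj⟩, (f, g), hmem, ?_, hfg⟩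
    intro k' hk' f' g' hfg' ht'
    obtain ⟨a, ha⟩ := hπ k' hk' f' g' hfg' ht'
    exact ⟨a, by omega⟩
  · refine (Finset.card_union_le _ _).trans (Nat.add_le_add_left ?_ _)
    refine Finset.card_biUnion_le.trans (Finset.sum_le_sum fun k _ => ?_)
    exact Finset.card_biUnion_le

theorem centralBinom_div_factorial_mul_le (i : ℕ) :
    ((13 + i).centralBinom : ℝ) / (13 + i).factorial * ((100 / 99 : ℝ) ^ (2 * (13 + i) - 1))
      ≤ 1 / 300 * (1 / 3) ^ i := by
  induction i with
  | zero =>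
    have h : (13).centralBinom = 10400600 := by
      norm_num [Nat.centralBinom, Nat.choose]
    simp only [Nat.add_zero, h, Nat.factorial]
    norm_num
  | succ i ih =>
    have hrec : (((13 + (i + 1)).centralBinom : ℕ) : ℝ) =
        2 * (2 * (13 + i) + 1) * (13 + i).centralBinom / (14 + i) := by
      have := Nat.succ_mul_centralBinom_succ (13 + i)
      rw [eq_div_iff (by positivity)]
      have h : (((13 + i + 1) * (13 + i + 1).centralBinom : ℕ) : ℝ) =
        ((2 * (2 * (13 + i) + 1) * (13 + i).centralBinom : ℕ) : ℝ) := by exact_mod_cast this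
      push_cast at h
      rw [← add_assoc]
      linarith
    have hfac : (((13 + (i + 1)).factorial : ℕ) : ℝ) = (14 + i) * (13 + i).factorial := by
      rw [← add_assoc, Nat.factorial_succ]
      push_cast
      ring
    have hpow : (100 / 99 : ℝ) ^ (2 * (13 + (i + 1)) - 1) =
        (100 / 99) ^ 2 * (100 / 99) ^ (2 * (13 + i) - 1) := by
      rw [← pow_add]
      congr 1
      omega
    have hratio : 2 * (2 * (13 + (i : ℝ)) + 1) / (14 + i) ^ 2 * (100 / 99) ^ 2 ≤ 1 / 3 := by
      have hi : (0 : ℝ) ≤ i := Nat.cast_nonneg i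
      rw [← le_div_iff₀ (by norm_num), div_le_iff₀ (by positivity)]
      nlinarith
    calc _ = (2 * (2 * (13 + (i : ℝ)) + 1) / (14 + i) ^ 2 * (100 / 99) ^ 2) *
          ((13 + i).centralBinom / (13 + i).factorial * (100 / 99) ^ (2 * (13 + i) - 1)) := by
          rw [hrec, hfac, hpow]
          have : ((13 + i).factorial : ℝ) ≠ 0 := by positivity
          field_simp
      _ ≤ 1 / 3 * (1 / 300 * (1 / 3) ^ i) := by gcongr
      _ = _ := by ring

theorem sum_centralBinom_div_factorial_mul_le (l : ℕ) :
    ∑ k ∈ Finset.Ico 13 l,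
      (k.centralBinom : ℝ) / k.factorial * ((100 / 99 : ℝ) ^ (2 * k - 1)) ≤ 1 / 100 := by
  rw [Finset.sum_Ico_eq_sum_range]
  refine (Finset.sum_le_sum fun i _ => centralBinom_div_factorial_mul_le i).trans ?_
  rw [← Finset.mul_sum, geom_sum_eq (by norm_num), show (1 / 3 - 1 : ℝ) = -(2 / 3) by norm_num,
    div_neg]
  have : (0 : ℝ) ≤ (1 / 3) ^ (l - 13) := by positivity
  linarith

/-- Adding one position keeps at least a proportion `99/100` of the good permutations. -/
theorem card_goodPerms_succ_ge (n j : ℕ) :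
    (99 / 100 : ℝ) * (goodPerms n j).card ≤ (goodPerms n (j + 1)).card := by
  classical
  induction j using Nat.strong_induction_on with
  | _ j ih =>
  have hgrow : ∀ i m, m + i ≤ j →
      ((goodPerms n m).card : ℝ) ≤ (100 / 99) ^ i * (goodPerms n (m + i)).card := by
    intro i
    induction i with
    | zero => simp
    | succ i ihi =>
      intro m hmi
      have h := ih (m + i) (by omega)
      calc ((goodPerms n m).card : ℝ) ≤ (100 / 99) ^ i * (goodPerms n (m + i)).card :=
            ihi m (by omega)
        _ ≤ (100 / 99) ^ i * (100 / 99 * (goodPerms n (m + i + 1)).card) := by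
            gcongr
            linarith
        _ = _ := by rw [pow_succ, add_assoc]; ring
  have hbound := card_goodPerms_le_add_sum n j
  have hsum : ((∑ k ∈ (Finset.Ico 13 (j + 2)).filter (fun k => 2 * k ≤ j + 1),
      ∑ p ∈ tightPairs n k (j + 1 - 2 * k),
        ((goodPerms n (j + 1 - 2 * k)).filter fun π => IsTwinPair π p.1 p.2).card : ℕ) : ℝ)
      ≤ 1 / 100 * (goodPerms n j).card := by
    push_cast
    calc _ ≤ ∑ k ∈ (Finset.Ico 13 (j + 2)).filter (fun k => 2 * k ≤ j + 1),
          (k.centralBinom : ℝ) / k.factorial * (100 / 99) ^ (2 * k - 1) *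
            (goodPerms n j).card := by
          refine Finset.sum_le_sum fun k hk => ?_
          rw [Finset.mem_filter, Finset.mem_Ico] at hk
          have hfac : (0 : ℝ) < k.factorial := by positivity
          have hm : ((goodPerms n (j + 1 - 2 * k)).card : ℝ) ≤
              (100 / 99) ^ (2 * k - 1) * (goodPerms n j).card := by
            have := hgrow (2 * k - 1) (j + 1 - 2 * k) (by omega)
            rwa [show j + 1 - 2 * k + (2 * k - 1) = j by omega] at this
          have hp : ∀ p ∈ tightPairs n k (j + 1 - 2 * k),
              (((goodPerms n (j + 1 - 2 * k)).filter
                fun π => IsTwinPair π p.1 p.2).card : ℝ) ≤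
              (100 / 99) ^ (2 * k - 1) * (goodPerms n j).card / k.factorial := by
            intro p hp
            obtain ⟨-, hg, hd, hb⟩ := mem_tightPairs.1 hp
            have h := factorial_mul_card_twins_le hg hd
              fun a => ((hb _).1 (Or.inr ⟨a, rfl⟩)).1
            rw [le_div_iff₀ hfac, mul_comm]
            exact le_trans (by exact_mod_cast h) hm
          refine (Finset.sum_le_sum hp).trans ?_
          rw [Finset.sum_const, nsmul_eq_mul]
          calc _ ≤ (k.centralBinom : ℝ) *
                ((100 / 99) ^ (2 * k - 1) * (goodPerms n j).card / k.factorial) := by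
                gcongr
                exact card_tightPairs_le n k _
            _ = _ := by ring
      _ ≤ ∑ k ∈ Finset.Ico 13 (j + 2),
          (k.centralBinom : ℝ) / k.factorial * (100 / 99) ^ (2 * k - 1) *
            (goodPerms n j).card :=
          Finset.sum_le_sum_of_subset_of_nonneg (Finset.filter_subset _ _)
            fun _ _ _ => by positivity
      _ ≤ _ := by
          rw [← Finset.sum_mul]
          gcongr
          exact sum_centralBinom_div_factorial_mul_le _
  have hbound' := (Nat.cast_le (α := ℝ)).2 hbound
  rw [Nat.cast_add] at hbound'
  linarith

theorem goodPerms_nonempty (n j : ℕ) : (goodPerms n j).Nonempty := by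
  induction j with
  | zero =>
    refine ⟨1, mem_goodPerms.2 fun k hk f g _ _ => ⟨⟨0, by omega⟩, Or.inl (Nat.zero_le _)⟩⟩
  | succ j ih =>
    have h := card_goodPerms_succ_ge n j
    have hpos : (0 : ℝ) < (goodPerms n j).card := by exact_mod_cast ih.card_pos
    rw [← Finset.card_pos]
    have : (0 : ℝ) < (goodPerms n (j + 1)).card := by linarith
    exact_mod_cast this

/-- For every $n ≥ 1$ there is a permutation of $[n]$ with no pair of tight twins of any
length $k ≥ 13$; in particular $tt(n) ≤ 12$. -/
theorem tight_twins_upper (n : ℕ) (hn : 1 ≤ n) :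
    (∃ π : Equiv.Perm (Fin n), ∀ k, 13 ≤ k → ¬ HasTightTwins π k) ∧ tt n ≤ 12 := by
  obtain ⟨π, hπ⟩ := goodPerms_nonempty n n
  have hfree : ∀ k, 13 ≤ k → ¬ HasTightTwins π k := by
    rintro k hk ⟨f, g, hfg, ht⟩
    obtain ⟨a, ha⟩ := mem_goodPerms.1 hπ k hk f g hfg ht
    have := (f a).isLt
    have := (g a).isLt
    omega
  have htt : ttPerm π ≤ 12 := csSup_le' fun k hk => by
    by_contra! hlt
    exact hfree k hlt hk
  have hle : tt n ≤ ttPerm π := Nat.sInf_le (Set.mem_range_self π)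
  exact ⟨⟨π, hfree⟩, hle.trans htt⟩
end

section
/- Let τ be a fixed permutation that is neither increasing nor decreasing (non-monotone). Then t(n, τ) = Θ(√n): (i) every permutation of [n] contains a pair of τ-avoiding twins of length at least ⌊√n / 2⌋; and (ii) there exists a constant C > 0 (depending only on τ) such that for every n there is a permutation of [n] containing no pair of τ-avoiding twins of length ⌈C·√n⌉. -/
/-- The sequence $u$ avoids the pattern $τ$: no subsequence of $u$ is order-isomorphic
to $τ$. -/
def AvoidsPattern {n k m : ℕ} (u : Fin k → Fin n) (τ : Equiv.Perm (Fin m)) : Prop :=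
  ¬ ∃ h : Fin m → Fin k, StrictMono h ∧ ∀ a b : Fin m, τ a < τ b ↔ u (h a) < u (h b)

/-- $π$ contains a pair of $τ$-avoiding twins of length $k$ (twins whose common
order-isomorphism type avoids $τ$). -/
def HasAvoidingTwins {n : ℕ} (π : Equiv.Perm (Fin n)) {m : ℕ} (τ : Equiv.Perm (Fin m))
    (k : ℕ) : Prop :=
  ∃ f g : Fin k → Fin n, IsTwinPair π f g ∧ AvoidsPattern (fun a => π (f a)) τ

section ChainTo

variable {α : Type*} {R : α → α → Prop}

/-- There is an `R`-chain with `k` steps ending at the given element. -/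
def ChainTo (R : α → α → Prop) : ℕ → α → Prop
  | 0, _ => True
  | k + 1, x => ∃ y, R y x ∧ ChainTo R k y

theorem ChainTo.exists_seq (hR : ∀ x y z, R x y → R y z → R x z) {k : ℕ} {x : α}
    (h : ChainTo R k x) :
    ∃ c : ℕ → α, c k = x ∧ ∀ a b, a < b → b ≤ k → R (c a) (c b) := by
  induction k generalizing x with
  | zero => exact ⟨fun _ => x, rfl, fun a b hab hb => by omega⟩
  | succ k ih =>
    obtain ⟨y, hy, hc⟩ := h
    obtain ⟨c, hck, hc⟩ := ih hc
    refine ⟨fun i => if i ≤ k then c i else x, by simp, fun a b hab hb => ?_⟩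
    have ha : a ≤ k := by omega
    by_cases hbk : b ≤ k
    · simpa [ha, hbk] using hc a b hab hbk
    · simp only [ha, hbk, if_true, if_false]
      rcases ha.lt_or_eq with h | rfl
      · exact hR _ _ _ (hck ▸ hc a k h le_rfl) hy
      · rwa [hck]

/-- If no element ends a chain with `Q` steps, there is a rank function into `{0, …, Q - 1}`
that increases along `R`. -/
theorem exists_rank_of_not_chainTo {Q : ℕ} (h : ∀ x, ¬ ChainTo R Q x) :
    ∃ rk : α → ℕ, (∀ x, rk x < Q) ∧ ∀ x y, R x y → rk x < rk y := by
  classical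
  have hC : ∀ x, ChainTo R (Nat.findGreatest (ChainTo R · x) Q) x := fun x =>
    Nat.findGreatest_spec (P := (ChainTo R · x)) (Nat.zero_le Q) trivial
  have hlt : ∀ x, Nat.findGreatest (ChainTo R · x) Q < Q := fun x =>
    lt_of_le_of_ne (Nat.findGreatest_le Q) fun e => h x (by have := hC x; rwa [e] at this)
  exact ⟨fun x => Nat.findGreatest (ChainTo R · x) Q, hlt, fun x y hxy =>
    Nat.le_findGreatest (hlt x) ⟨x, hxy, hC x⟩⟩

end ChainTo

/-- Erdős–Szekeres: an injective sequence of length more than `Q ^ 2` has a monotone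
subsequence of length `Q + 1`. -/
theorem exists_increasing_or_decreasing_seq {n Q : ℕ} (π : Fin n → Fin n)
    (hπ : Function.Injective π) (hn : Q * Q < n) :
    ∃ c : ℕ → Fin n, (∀ a b, a < b → b ≤ Q → c a < c b ∧ π (c a) < π (c b)) ∨
      (∀ a b, a < b → b ≤ Q → c a < c b ∧ π (c b) < π (c a)) := by
  by_contra hno
  push Not at hno
  obtain ⟨u, hu, hu'⟩ := exists_rank_of_not_chainTo (Q := Q)
    (R := fun i j : Fin n => i < j ∧ π i < π j) fun x hx => by
      obtain ⟨c, -, hc⟩ := hx.exists_seq fun x y z h₁ h₂ => ⟨h₁.1.trans h₂.1, h₁.2.trans h₂.2⟩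
      obtain ⟨a, b, hab, hb, h⟩ := (hno c).1
      exact absurd (hc a b hab hb).2 (not_lt.2 (h (hc a b hab hb).1))
  obtain ⟨v, hv, hv'⟩ := exists_rank_of_not_chainTo (Q := Q)
    (R := fun i j : Fin n => i < j ∧ π j < π i) fun x hx => by
      obtain ⟨c, -, hc⟩ := hx.exists_seq fun x y z h₁ h₂ => ⟨h₁.1.trans h₂.1, h₂.2.trans h₁.2⟩
      obtain ⟨a, b, hab, hb, h⟩ := (hno c).2
      exact absurd (hc a b hab hb).2 (not_lt.2 (h (hc a b hab hb).1))
  have hne : ∀ i j : Fin n, i < j → (u i, v i) ≠ (u j, v j) := fun i j hij e => by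
    rw [Prod.mk.injEq] at e
    rcases lt_or_gt_of_ne (hπ.ne hij.ne) with h | h
    · exact (hu' i j ⟨hij, h⟩).ne e.1
    · exact (hv' i j ⟨hij, h⟩).ne e.2
  have hinj : Function.Injective fun i => (u i, v i) := fun i j e => by
    by_contra hij
    rcases lt_or_gt_of_ne hij with h | h
    · exact hne i j h e
    · exact hne j i h e.symm
  have hcard : (Finset.univ : Finset (Fin n)).card ≤ (Finset.range Q ×ˢ Finset.range Q).card :=
    Finset.card_le_card_of_injOn (fun i => (u i, v i)) (fun i _ => by simp [hu i, hv i])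
      hinj.injOn
  simp at hcard
  omega

/-- Every permutation of `[n]` has `τ`-avoiding twins of length `⌊√n / 2⌋` when `τ` is not
monotone. -/
theorem hasAvoidingTwins_sqrt_div_two {m : ℕ} {τ : Equiv.Perm (Fin m)}
    (hmono : ¬ Monotone ⇑τ) (hanti : ¬ Antitone ⇑τ) {n : ℕ} (hn : 1 ≤ n)
    (π : Equiv.Perm (Fin n)) : HasAvoidingTwins π τ (Nat.sqrt n / 2) := by
  obtain ⟨Q, hQ⟩ : ∃ Q, Nat.sqrt n = Q + 1 := ⟨_, (Nat.succ_pred (Nat.sqrt_pos.2 hn).ne').symm⟩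
  have hlt : Q * Q < n := by
    have := Nat.sqrt_le n
    rw [hQ] at this
    nlinarith
  rw [hQ]
  obtain ⟨c, hc | hc⟩ := exists_increasing_or_decreasing_seq π π.injective hlt
  all_goals
    have hpos : ∀ a b, a < b → b ≤ Q → c a < c b := fun a b hab hb => (hc a b hab hb).1
    have hval : ∀ a b, a < b → b ≤ Q → _ := fun a b hab hb => (hc a b hab hb).2
    refine ⟨fun a => c a, fun a => c (a + (Q + 1) / 2), ⟨fun a b hab => hpos _ _ hab (by omega),
      fun a b hab => hpos _ _ (by have : (a : ℕ) < b := hab; omega) (by omega),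
      fun a b => (hpos _ _ (by omega) (by omega)).ne, fun a b => ?_⟩, ?_⟩
    · rcases lt_trichotomy a b with h | rfl | h
      · have h' : (a : ℕ) < b := h
        have h₁ := hval a b h' (by omega)
        have h₂ := hval (a + (Q + 1) / 2) (b + (Q + 1) / 2) (by omega) (by omega)
        first
          | exact iff_of_true h₁ h₂
          | exact iff_of_false h₁.not_gt h₂.not_gt
      · simp
      · have h' : (b : ℕ) < a := h
        have h₁ := hval b a h' (by omega)
        have h₂ := hval (b + (Q + 1) / 2) (a + (Q + 1) / 2) (by omega) (by omega)
        first
          | exact iff_of_true h₁ h₂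
          | exact iff_of_false h₁.not_gt h₂.not_gt
    · rintro ⟨h, hh, hτ⟩
      first
        | refine hmono (StrictMono.monotone fun a b hab => ?_)
          exact (hτ a b).2 (hval _ _ (hh hab) (by omega))
        | refine hanti (StrictAnti.antitone fun a b hab => ?_)
          exact (hτ b a).2 (hval _ _ (hh hab) (by omega))

section MatrixContains

open Finset

variable {m : ℕ}

/-- The 0-1 matrix with set of ones `S` contains the permutation matrix of `τ`. -/
def MatrixContains (S : Finset (ℕ × ℕ)) (τ : Equiv.Perm (Fin m)) : Prop :=
  ∃ r c : Fin m → ℕ, StrictMono r ∧ StrictMono c ∧ ∀ a, (r a, c (τ a)) ∈ S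

/-- The positions of an `N × N` matrix. -/
def grid (N : ℕ) : Finset (ℕ × ℕ) := range N ×ˢ range N

/-- Replace each `q × q` block by a single entry, which is one iff the block is nonzero. -/
def contract (q : ℕ) (S : Finset (ℕ × ℕ)) : Finset (ℕ × ℕ) :=
  S.image fun p => (p.1 / q, p.2 / q)

/-- The part of `S` in the `q × q` block with index `v`. -/
def cell (q : ℕ) (S : Finset (ℕ × ℕ)) (v : ℕ × ℕ) : Finset (ℕ × ℕ) :=
  S.filter fun p => (p.1 / q, p.2 / q) = v

theorem mem_cell {q : ℕ} {S : Finset (ℕ × ℕ)} {v p : ℕ × ℕ} :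
    p ∈ cell q S v ↔ p ∈ S ∧ p.1 / q = v.1 ∧ p.2 / q = v.2 := by
  simp [cell, Prod.ext_iff]

theorem lt_of_div_lt_div {a b q : ℕ} (h : a / q < b / q) : a < b :=
  lt_of_not_ge fun hba => h.not_ge (Nat.div_le_div_right hba)

theorem MatrixContains.of_contract {q : ℕ} {S : Finset (ℕ × ℕ)} {τ : Equiv.Perm (Fin m)}
    (h : MatrixContains (contract q S) τ) : MatrixContains S τ := by
  obtain ⟨r, c, hr, hc, h⟩ := h
  simp only [contract, mem_image, Prod.mk.injEq] at h
  choose p hpS hp₁ hp₂ using h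
  refine ⟨fun a => (p a).1, fun b => (p (τ.symm b)).2,
    fun a b hab => lt_of_div_lt_div (q := q) ?_, fun a b hab => lt_of_div_lt_div (q := q) ?_,
    fun a => by simpa using hpS a⟩
  · simpa [hp₁] using hr hab
  · simpa [hp₂] using hc hab

theorem MatrixContains.of_swap {S : Finset (ℕ × ℕ)} {τ : Equiv.Perm (Fin m)}
    (h : MatrixContains (S.image Prod.swap) τ.symm) : MatrixContains S τ := by
  obtain ⟨r, c, hr, hc, h⟩ := h
  refine ⟨c, r, hc, hr, fun a => ?_⟩
  have := h (τ a)
  simpa using this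

theorem contract_subset_grid {q N : ℕ} {S : Finset (ℕ × ℕ)} (hS : S ⊆ grid (q * N)) :
    contract q S ⊆ grid N := by
  intro v hv
  simp only [contract, mem_image] at hv
  obtain ⟨p, hp, rfl⟩ := hv
  have := hS hp
  simp only [grid, mem_product, mem_range] at this ⊢
  exact ⟨Nat.div_lt_of_lt_mul this.1, Nat.div_lt_of_lt_mul this.2⟩

theorem mem_Ico_of_div_eq {q x J : ℕ} (hq : 0 < q) (h : x / q = J) :
    x ∈ Ico (J * q) (J * q + q) := by
  rw [Nat.div_eq_iff hq] at h
  simp only [mem_Ico]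
  omega

/-- In a column of blocks, few blocks have at least `m` nonzero columns. -/
theorem card_wide_le {q : ℕ} (hq : 0 < q) {S : Finset (ℕ × ℕ)} {τ : Equiv.Perm (Fin m)}
    (hS : ¬ MatrixContains S τ) (N J : ℕ) :
    #{I ∈ range N | m ≤ #((cell q S (I, J)).image Prod.snd)} ≤ q.choose m * m := by
  by_contra! hlt
  have hT : ∀ I, ∃ T : Finset ℕ, m ≤ #((cell q S (I, J)).image Prod.snd) →
      T ⊆ (cell q S (I, J)).image Prod.snd ∧ #T = m := fun I => by
    by_cases h : m ≤ #((cell q S (I, J)).image Prod.snd)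
    · obtain ⟨T, hT⟩ := exists_subset_card_eq h
      exact ⟨T, fun _ => hT⟩
    · exact ⟨∅, fun h' => absurd h' h⟩
  choose T hT using hT
  obtain ⟨U, hU, hcard⟩ := exists_lt_card_fiber_of_mul_lt_card_of_maps_to
    (t := powersetCard m (Ico (J * q) (J * q + q))) (f := T) (n := m)
    (fun I hI => by
      obtain ⟨hsub, hc⟩ := hT I (mem_filter.1 hI).2
      refine mem_powersetCard.2 ⟨fun y hy => ?_, hc⟩
      obtain ⟨p, hp, rfl⟩ := mem_image.1 (hsub hy)
      exact mem_Ico_of_div_eq hq (mem_cell.1 hp).2.2)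
    (by simpa using hlt)
  obtain ⟨V, hV, hVc⟩ := exists_subset_card_eq hcard.le
  have hmem : ∀ a b : Fin m, ∃ x, (x, U.orderEmbOfFin (mem_powersetCard.1 hU).2 b) ∈ S ∧
      x / q = V.orderEmbOfFin hVc a := fun a b => by
    have hI := mem_filter.1 (hV (V.orderEmbOfFin_mem hVc a))
    have hsub := (hT _ (mem_filter.1 hI.1).2).1
    rw [hI.2] at hsub
    have hb := hsub (U.orderEmbOfFin_mem (mem_powersetCard.1 hU).2 b)
    obtain ⟨⟨x, y⟩, hp, hy⟩ := mem_image.1 hb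
    rw [mem_cell] at hp
    exact ⟨x, by rw [← hy]; exact hp.1, hp.2.1⟩
  choose x hxS hx using hmem
  refine hS ⟨fun a => x a (τ a), fun b => U.orderEmbOfFin (mem_powersetCard.1 hU).2 b,
    fun a b hab => lt_of_div_lt_div (q := q) ?_, (U.orderEmbOfFin _).strictMono,
    fun a => hxS a (τ a)⟩
  rw [hx, hx]
  exact (V.orderEmbOfFin hVc).strictMono hab

/-- In a row of blocks, few blocks have at least `m` nonzero rows. -/
theorem card_tall_le {q : ℕ} (hq : 0 < q) {S : Finset (ℕ × ℕ)} {τ : Equiv.Perm (Fin m)}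
    (hS : ¬ MatrixContains S τ) (N I : ℕ) :
    #{J ∈ range N | m ≤ #((cell q S (I, J)).image Prod.fst)} ≤ q.choose m * m := by
  have hswap : ∀ J, (cell q (S.image Prod.swap) (J, I)).image Prod.snd =
      (cell q S (I, J)).image Prod.fst := fun J => by
    ext x
    simp only [mem_image, mem_cell, Prod.exists, Prod.swap_prod_mk, Prod.mk.injEq]
    grind
  simpa only [hswap] using card_wide_le hq (fun h => hS (MatrixContains.of_swap h)) N I
theorem card_cell_le_sq {q : ℕ} (hq : 0 < q) (S : Finset (ℕ × ℕ)) (v : ℕ × ℕ) :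
    #(cell q S v) ≤ q ^ 2 := by
  have hsub : cell q S v ⊆
      Ico (v.1 * q) (v.1 * q + q) ×ˢ Ico (v.2 * q) (v.2 * q + q) := fun p hp => by
    rw [mem_cell] at hp
    exact mem_product.2 ⟨mem_Ico_of_div_eq hq hp.2.1, mem_Ico_of_div_eq hq hp.2.2⟩
  simpa [sq] using card_le_card hsub

/-- A block that is neither wide nor tall has few ones. -/
theorem card_cell_le {q : ℕ} (hq : 0 < q) (s : ℕ) (S : Finset (ℕ × ℕ)) (v : ℕ × ℕ) :
    #(cell q S v) ≤ s ^ 2 + (if s + 1 ≤ #((cell q S v).image Prod.snd) then q ^ 2 else 0) +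
      (if s + 1 ≤ #((cell q S v).image Prod.fst) then q ^ 2 else 0) := by
  have h₁ := card_cell_le_sq hq S v
  split_ifs with hw ht ht
  · omega
  · omega
  · omega
  · have hsub : cell q S v ⊆ (cell q S v).image Prod.fst ×ˢ (cell q S v).image Prod.snd :=
      subset_product
    have h₂ := card_le_card hsub
    rw [card_product] at h₂
    calc #(cell q S v) ≤ _ := h₂
      _ ≤ s * s := Nat.mul_le_mul (by omega) (by omega)
      _ = _ := by ring

theorem card_le_card_contract {q s N : ℕ} (hq : 0 < q) {S : Finset (ℕ × ℕ)}
    {τ : Equiv.Perm (Fin (s + 1))} (hS : ¬ MatrixContains S τ) (hSN : S ⊆ grid (q * N)) :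
    #S ≤ s ^ 2 * #(contract q S) + 2 * (N * (q.choose (s + 1) * (s + 1) * q ^ 2)) := by
  have hsub := contract_subset_grid hSN
  have hwide : ∑ v ∈ grid N, (if s + 1 ≤ #((cell q S v).image Prod.snd) then q ^ 2 else 0) ≤
      N * (q.choose (s + 1) * (s + 1) * q ^ 2) := by
    rw [grid, sum_product_right]
    refine (sum_le_card_nsmul _ _ (q.choose (s + 1) * (s + 1) * q ^ 2) fun J _ => ?_).trans
      (by simp)
    rw [← sum_filter, sum_const, smul_eq_mul]
    exact Nat.mul_le_mul_right _ (card_wide_le hq hS N J)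
  have htall : ∑ v ∈ grid N, (if s + 1 ≤ #((cell q S v).image Prod.fst) then q ^ 2 else 0) ≤
      N * (q.choose (s + 1) * (s + 1) * q ^ 2) := by
    rw [grid, sum_product]
    refine (sum_le_card_nsmul _ _ (q.choose (s + 1) * (s + 1) * q ^ 2) fun I _ => ?_).trans
      (by simp)
    rw [← sum_filter, sum_const, smul_eq_mul]
    exact Nat.mul_le_mul_right _ (card_tall_le hq hS N I)
  calc #S = ∑ v ∈ contract q S, #(cell q S v) := card_eq_sum_card_image _ S
    _ ≤ ∑ v ∈ contract q S, (s ^ 2 +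
          (if s + 1 ≤ #((cell q S v).image Prod.snd) then q ^ 2 else 0) +
          (if s + 1 ≤ #((cell q S v).image Prod.fst) then q ^ 2 else 0)) :=
        sum_le_sum fun v _ => card_cell_le hq s S v
    _ ≤ s ^ 2 * #(contract q S) +
          ∑ v ∈ grid N, (if s + 1 ≤ #((cell q S v).image Prod.snd) then q ^ 2 else 0) +
          ∑ v ∈ grid N, (if s + 1 ≤ #((cell q S v).image Prod.fst) then q ^ 2 else 0) := by
        rw [sum_add_distrib, sum_add_distrib, sum_const, smul_eq_mul, mul_comm]
        gcongr
    _ ≤ _ := by omega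

theorem exists_pow_between {q N : ℕ} (hq : 1 < q) (hN : N ≠ 0) :
    ∃ j, N ≤ q ^ j ∧ q ^ j ≤ q * N :=
  ⟨Nat.log q N + 1, (Nat.lt_pow_succ_log_self hq N).le, by
    rw [pow_succ']
    exact Nat.mul_le_mul_left _ (Nat.pow_log_le_self q hN)⟩

theorem grid_mono {M N : ℕ} (h : M ≤ N) : grid M ⊆ grid N :=
  product_subset_product (range_subset_range.2 h) (range_subset_range.2 h)

theorem card_le_of_subset_grid_pow {s : ℕ} {τ : Equiv.Perm (Fin (s + 1))} (j : ℕ) :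
    ∀ S : Finset (ℕ × ℕ), S ⊆ grid (((s + 1) ^ 2) ^ j) → ¬ MatrixContains S τ →
      #S ≤ 2 * (((s + 1) ^ 2).choose (s + 1) * (s + 1) * ((s + 1) ^ 2) ^ 2) *
        ((s + 1) ^ 2) ^ j := by
  have hq : 0 < (s + 1) ^ 2 := by positivity
  induction j with
  | zero =>
    intro S hS _
    have h₁ : #S ≤ 1 := by simpa [grid] using card_le_card hS
    have h₂ : 0 < ((s + 1) ^ 2).choose (s + 1) := Nat.choose_pos (by nlinarith)
    refine h₁.trans (Nat.one_le_iff_ne_zero.2 ?_)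
    positivity
  | succ j ih =>
    intro S hS hτ
    rw [pow_succ'] at hS
    have h₁ := card_le_card_contract hq hτ hS
    have h₂ := ih _ (contract_subset_grid hS) fun h => hτ h.of_contract
    rw [pow_succ' ((s + 1) ^ 2) j]
    generalize ((s + 1) ^ 2) ^ j = P at *
    calc #S ≤ _ := h₁
      _ ≤ _ := Nat.add_le_add_right (Nat.mul_le_mul_left _ h₂) _
      _ ≤ _ := by
        generalize ((s + 1) ^ 2).choose (s + 1) * (s + 1) * ((s + 1) ^ 2) ^ 2 = D
        have : (0 : ℕ) ≤ s * (D * P) := Nat.zero_le _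
        nlinarith

/-- The Füredi–Hajnal conjecture (Marcus–Tardos theorem). -/
theorem exists_card_le_of_not_matrixContains {m : ℕ} (hm : 2 ≤ m) (τ : Equiv.Perm (Fin m)) :
    ∃ K : ℕ, ∀ N S, S ⊆ grid N → ¬ MatrixContains S τ → #S ≤ K * N := by
  obtain ⟨s, rfl⟩ : ∃ s, m = s + 1 := ⟨m - 1, by omega⟩
  refine ⟨2 * (((s + 1) ^ 2).choose (s + 1) * (s + 1) * ((s + 1) ^ 2) ^ 2) * (s + 1) ^ 2,
    fun N S hS hτ => ?_⟩
  rcases Nat.eq_zero_or_pos N with rfl | hN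
  · simpa [grid] using hS
  · obtain ⟨j, hj, hj'⟩ := exists_pow_between (q := (s + 1) ^ 2) (by nlinarith) hN.ne'
    refine (card_le_of_subset_grid_pow j S (hS.trans (grid_mono hj)) hτ).trans ?_
    rw [mul_assoc _ ((s + 1) ^ 2) N]
    exact Nat.mul_le_mul_left _ hj'

open Classical in
/-- The `N × N` 0-1 matrices avoiding `τ`. -/
noncomputable def avoidingMatrices (τ : Equiv.Perm (Fin m)) (N : ℕ) :
    Finset (Finset (ℕ × ℕ)) :=
  {S ∈ (grid N).powerset | ¬ MatrixContains S τ}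

theorem mem_avoidingMatrices {τ : Equiv.Perm (Fin m)} {N : ℕ} {S : Finset (ℕ × ℕ)} :
    S ∈ avoidingMatrices τ N ↔ S ⊆ grid N ∧ ¬ MatrixContains S τ := by
  simp [avoidingMatrices]

theorem card_contract_two_fiber_le (A : Finset (Finset (ℕ × ℕ))) (T : Finset (ℕ × ℕ)) :
    #{S ∈ A | contract 2 S = T} ≤ 2 ^ (#T * 4) := by
  have hsub : {S ∈ A | contract 2 S = T} ⊆
      (T.biUnion fun v => ({2 * v.1, 2 * v.1 + 1} : Finset ℕ) ×ˢ
        ({2 * v.2, 2 * v.2 + 1} : Finset ℕ)).powerset := fun S hS => by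
    rw [mem_powerset]
    intro p hp
    have hv : (p.1 / 2, p.2 / 2) ∈ T := by
      rw [← (mem_filter.1 hS).2]
      exact mem_image_of_mem _ hp
    refine mem_biUnion.2 ⟨_, hv, ?_⟩
    simp only [mem_product, mem_insert, mem_singleton]
    omega
  refine (card_le_card hsub).trans ?_
  rw [card_powerset]
  refine Nat.pow_le_pow_right two_pos (card_biUnion_le_card_mul _ _ _ fun v _ => ?_)
  rw [card_product]
  exact Nat.mul_le_mul card_le_two card_le_two

/-- Klazar's reduction: matrices avoiding `τ` are exponentially few once their number of ones
is linearly bounded. -/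
theorem card_avoidingMatrices_two_pow_le {τ : Equiv.Perm (Fin m)} {K : ℕ} (hK : 0 < K)
    (h : ∀ N S, S ⊆ grid N → ¬ MatrixContains S τ → #S ≤ K * N) (j : ℕ) :
    #(avoidingMatrices τ (2 ^ j)) ≤ 2 ^ (K * 4 * 2 ^ j) := by
  induction j with
  | zero =>
    calc #(avoidingMatrices τ (2 ^ 0)) ≤ #(grid (2 ^ 0)).powerset :=
          card_le_card fun S hS => mem_powerset.2 (mem_avoidingMatrices.1 hS).1
      _ = 2 ^ 1 := by simp [grid]
      _ ≤ _ := Nat.pow_le_pow_right two_pos (by omega)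
  | succ j ih =>
    have hmaps : ∀ S ∈ avoidingMatrices τ (2 ^ (j + 1)),
        contract 2 S ∈ avoidingMatrices τ (2 ^ j) := fun S hS => by
      rw [mem_avoidingMatrices, pow_succ'] at hS
      exact mem_avoidingMatrices.2
        ⟨contract_subset_grid hS.1, fun h' => hS.2 h'.of_contract⟩
    calc #(avoidingMatrices τ (2 ^ (j + 1)))
        ≤ 2 ^ (K * 2 ^ j * 4) * #(avoidingMatrices τ (2 ^ j)) :=
          card_le_mul_card_image_of_maps_to hmaps _ fun T hT => by
            rw [mem_avoidingMatrices] at hT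
            exact (card_contract_two_fiber_le _ T).trans
              (Nat.pow_le_pow_right two_pos (Nat.mul_le_mul_right _ (h _ _ hT.1 hT.2)))
      _ ≤ 2 ^ (K * 2 ^ j * 4) * 2 ^ (K * 4 * 2 ^ j) := Nat.mul_le_mul_left _ ih
      _ = _ := by rw [← pow_add]; ring_nf

open Classical in
/-- The Stanley–Wilf conjecture: exponentially few permutations avoid `τ`. -/
theorem exists_card_avoidsPattern_le {m : ℕ} (hm : 2 ≤ m) (τ : Equiv.Perm (Fin m)) :
    ∃ c : ℕ, ∀ k, #{σ : Equiv.Perm (Fin k) | AvoidsPattern σ τ} ≤ c ^ k := by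
  obtain ⟨K, hK⟩ := exists_card_le_of_not_matrixContains hm τ
  refine ⟨2 ^ ((K + 1) * 8), fun k => ?_⟩
  rcases Nat.eq_zero_or_pos k with rfl | hk
  · exact (card_filter_le _ _).trans (by simp)
  obtain ⟨j, hj, hj'⟩ := exists_pow_between one_lt_two hk.ne'
  calc #{σ : Equiv.Perm (Fin k) | AvoidsPattern σ τ} ≤ #(avoidingMatrices τ (2 ^ j)) := by
        refine card_le_card_of_injOn
          (fun σ => univ.image fun i : Fin k => ((i : ℕ), (σ i : ℕ))) (fun σ hσ => ?_)
          fun σ _ ρ _ hσρ => ?_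
        · refine mem_avoidingMatrices.2 ⟨fun p hp => ?_, ?_⟩
          · obtain ⟨i, -, rfl⟩ := mem_image.1 hp
            simp only [grid, mem_product, mem_range]
            omega
          · rintro ⟨r, c, hr, hc, h⟩
            simp only [mem_image, mem_univ, true_and, Prod.mk.injEq] at h
            choose i hi hσi using h
            refine (mem_filter.1 hσ).2 ⟨i, fun a b hab => ?_, fun a b => ?_⟩
            · rw [Fin.lt_def, hi, hi]
              exact hr hab
            · rw [Fin.lt_def (a := σ (i a)), hσi, hσi, hc.lt_iff_lt]
        · ext i
          have : ((i : ℕ), (σ i : ℕ)) ∈ univ.image fun i : Fin k => ((i : ℕ), (ρ i : ℕ)) := by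
            dsimp only at hσρ
            rw [← hσρ]
            exact mem_image_of_mem (fun i : Fin k => ((i : ℕ), (σ i : ℕ))) (mem_univ i)
          obtain ⟨i', -, h⟩ := mem_image.1 this
          rw [Prod.mk.injEq] at h
          rw [← h.2, Fin.ext h.1]
    _ ≤ 2 ^ ((K + 1) * 4 * 2 ^ j) :=
        card_avoidingMatrices_two_pow_le K.succ_pos
          (fun N S hS hτ => (hK N S hS hτ).trans (by nlinarith)) j
    _ ≤ 2 ^ ((K + 1) * 8 * k) := Nat.pow_le_pow_right two_pos (by nlinarith)
    _ = _ := pow_mul _ _ _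

end MatrixContains

section Counting

open Finset

open scoped Nat

variable {k n : ℕ}

theorem perm_eq_of_lt_iff {σ ρ : Equiv.Perm (Fin k)} (h : ∀ a b, σ a < σ b ↔ ρ a < ρ b) :
    σ = ρ := by
  have hmono : StrictMono (ρ.symm.trans σ) := fun a b hab => by simpa [h] using hab
  have := (Equiv.Perm.monotone_iff _).1 hmono.monotone
  ext a
  simpa using congrArg Fin.val (congrArg (· (ρ a)) this)

/-- Every injective sequence has a pattern. -/
theorem exists_perm_lt_iff {u : Fin k → Fin n} (hu : Function.Injective u) :
    ∃ σ : Equiv.Perm (Fin k), ∀ a b, u a < u b ↔ σ a < σ b := by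
  refine ⟨(Tuple.sort u).symm, fun a b => ?_⟩
  have hmono : StrictMono (u ∘ Tuple.sort u) :=
    (Tuple.monotone_sort u).strictMono_of_injective (hu.comp (Tuple.sort u).injective)
  simpa using hmono.lt_iff_lt (a := (Tuple.sort u).symm a) (b := (Tuple.sort u).symm b)

open Classical in
/-- A given pair of disjoint position sequences shows a given pattern twice in at most
`n! / (k!) ^ 2` permutations. -/
theorem factorial_sq_mul_card_twins_le (f g : Fin k ↪ Fin n) (hfg : ∀ a b, f a ≠ g b)
    (σ : Equiv.Perm (Fin k)) :
    k ! ^ 2 * #{π : Equiv.Perm (Fin n) | (∀ a b, π (f a) < π (f b) ↔ σ a < σ b) ∧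
      ∀ a b, π (g a) < π (g b) ↔ σ a < σ b} ≤ n ! := by
  set E : Finset (Equiv.Perm (Fin n)) := {π | (∀ a b, π (f a) < π (f b) ↔ σ a < σ b) ∧
      ∀ a b, π (g a) < π (g b) ↔ σ a < σ b} with hE
  let shuffle : Equiv.Perm (Fin k) × Equiv.Perm (Fin k) → Equiv.Perm (Fin n) := fun x =>
    x.1.viaFintypeEmbedding f * x.2.viaFintypeEmbedding g
  have hf : ∀ x a, shuffle x (f a) = f (x.1 a) := fun x a => by
    have : f a ∉ Set.range g := fun ⟨b, hb⟩ => hfg a b hb.symm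
    simp [shuffle, Equiv.Perm.viaFintypeEmbedding_apply_notMem_range, this]
  have hg : ∀ x a, shuffle x (g a) = g (x.2 a) := fun x a => by
    have : g (x.2 a) ∉ Set.range f := fun ⟨b, hb⟩ => hfg b _ hb
    simp [shuffle, Equiv.Perm.viaFintypeEmbedding_apply_notMem_range, this]
  have hcard : #((univ : Finset (Equiv.Perm (Fin k) × Equiv.Perm (Fin k))) ×ˢ E) ≤
      #(univ : Finset (Equiv.Perm (Fin n))) := by
    refine card_le_card_of_injOn (fun y => y.2 * shuffle y.1) (fun _ _ => by simp) ?_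
    rintro ⟨x, π⟩ hx ⟨x', π'⟩ hx' h
    have hπ := (mem_filter.1 (mem_product.1 hx).2).2
    have hπ' := (mem_filter.1 (mem_product.1 hx').2).2
    have happ : ∀ i, π (shuffle x i) = π' (shuffle x' i) := fun i => congrArg (· i) h
    have h₁ : σ * x.1 = σ * x'.1 := perm_eq_of_lt_iff fun a b => by
      have ha := happ (f a)
      have hb := happ (f b)
      rw [hf, hf] at ha hb
      simp only [Equiv.Perm.mul_apply]
      rw [← hπ.1, ← hπ'.1, ha, hb]
    have h₂ : σ * x.2 = σ * x'.2 := perm_eq_of_lt_iff fun a b => by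
      have ha := happ (g a)
      have hb := happ (g b)
      rw [hg, hg] at ha hb
      simp only [Equiv.Perm.mul_apply]
      rw [← hπ.2, ← hπ'.2, ha, hb]
    obtain rfl : x = x' := Prod.ext (mul_left_cancel h₁) (mul_left_cancel h₂)
    exact Prod.ext rfl (mul_right_cancel (show π * shuffle x = π' * shuffle x from h))
  simpa [Fintype.card_perm, sq] using hcard

theorem card_strictMono_le [DecidablePred fun f : Fin k → Fin n => StrictMono f] :
    #{f : Fin k → Fin n | StrictMono f} ≤ n.choose k := by
  calc #{f : Fin k → Fin n | StrictMono f}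
      ≤ #(powersetCard k (univ : Finset (Fin n))) := by
        refine card_le_card_of_injOn (fun f => univ.image f) (fun f hf => ?_)
          fun f hf g hg hfg => ?_
        · have hf : StrictMono f := (mem_filter.1 hf).2
          exact mem_powersetCard.2
            ⟨subset_univ _, by rw [card_image_of_injective _ hf.injective, card_fin]⟩
        · refine (StrictMono.range_inj (mem_filter.1 hf).2 (mem_filter.1 hg).2).1 ?_
          simpa using congrArg (fun s : Finset (Fin n) => (s : Set (Fin n))) hfg
    _ = n.choose k := by simp

open Classical in
/-- Union bound for the number of permutations with `τ`-avoiding twins of length `k`. -/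
theorem factorial_sq_mul_card_hasAvoidingTwins_le {m : ℕ} (τ : Equiv.Perm (Fin m)) :
    k ! ^ 2 * #{π : Equiv.Perm (Fin n) | HasAvoidingTwins π τ k} ≤
      n.choose k ^ 2 * #{σ : Equiv.Perm (Fin k) | AvoidsPattern σ τ} * n ! := by
  set M : Finset (Fin k → Fin n) := {f | StrictMono f} with hM
  set A : Finset (Equiv.Perm (Fin k)) := {σ | AvoidsPattern σ τ} with hA
  let E : ((Fin k → Fin n) × (Fin k → Fin n)) × Equiv.Perm (Fin k) →
      Finset (Equiv.Perm (Fin n)) := fun y =>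
    {π | (∀ a b, y.1.1 a ≠ y.1.2 b) ∧ (∀ a b, π (y.1.1 a) < π (y.1.1 b) ↔ y.2 a < y.2 b) ∧
      ∀ a b, π (y.1.2 a) < π (y.1.2 b) ↔ y.2 a < y.2 b}
  have hsub : ({π | HasAvoidingTwins π τ k} : Finset (Equiv.Perm (Fin n))) ⊆
      ((M ×ˢ M) ×ˢ A).biUnion E := fun π hπ => by
    obtain ⟨f, g, ⟨hf, hg, hfg, hiff⟩, hτ⟩ := (mem_filter.1 hπ).2
    obtain ⟨σ, hσ⟩ := exists_perm_lt_iff (π.injective.comp hf.injective)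
    have hσA : AvoidsPattern σ τ := fun ⟨h, hh, hlt⟩ =>
      hτ ⟨h, hh, fun a b => (hlt a b).trans (hσ _ _).symm⟩
    exact mem_biUnion.2 ⟨((f, g), σ), by simp [hM, hA, hf, hg, hσA],
      mem_filter.2 ⟨mem_univ _, hfg, hσ, fun a b => (hiff a b).symm.trans (hσ a b)⟩⟩
  have hE : ∀ y ∈ (M ×ˢ M) ×ˢ A, k ! ^ 2 * #(E y) ≤ n ! := by
    rintro ⟨⟨f, g⟩, σ⟩ hy
    simp only [mem_product, hM, mem_filter, mem_univ, true_and] at hy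
    by_cases hfg : ∀ a b, f a ≠ g b
    · refine (Nat.mul_le_mul_left _ (card_le_card fun π hπ => ?_)).trans
        (factorial_sq_mul_card_twins_le ⟨f, hy.1.1.injective⟩ ⟨g, hy.1.2.injective⟩ hfg σ)
      exact mem_filter.2 ⟨mem_univ _, (mem_filter.1 hπ).2.2⟩
    · simp [E, hfg]
  calc k ! ^ 2 * #{π : Equiv.Perm (Fin n) | HasAvoidingTwins π τ k}
      ≤ k ! ^ 2 * ∑ y ∈ (M ×ˢ M) ×ˢ A, #(E y) :=
        Nat.mul_le_mul_left _ ((card_le_card hsub).trans card_biUnion_le)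
    _ = ∑ y ∈ (M ×ˢ M) ×ˢ A, k ! ^ 2 * #(E y) := mul_sum _ _ _
    _ ≤ #((M ×ˢ M) ×ˢ A) * n ! := sum_le_card_nsmul _ _ _ hE
    _ = #M ^ 2 * #A * n ! := by rw [card_product, card_product, sq]
    _ ≤ _ := by
        gcongr
        exact card_strictMono_le

theorem choose_sq_mul_pow_lt_factorial_sq {c : ℕ} (hk : 0 < k)
    (h : Real.exp 1 * (c + 1) * √n ≤ k) : n.choose k ^ 2 * c ^ k < k ! ^ 2 := by
  have hfac : (0 : ℝ) < k ! := by positivity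
  have hexp : ((k : ℝ) / Real.exp 1) ^ k ≤ k ! := by
    have := Real.pow_div_factorial_le_exp (x := k) (by positivity) k
    rw [div_pow, ← Real.exp_nat_mul, mul_one]
    rw [div_le_iff₀ hfac] at this
    rw [div_le_iff₀ (Real.exp_pos _)]
    linarith
  have hroot : (c + 1) * √n ≤ k / Real.exp 1 := by
    rw [le_div_iff₀ (Real.exp_pos _)]
    linarith
  have hkpos : (0 : ℝ) < k / Real.exp 1 := by positivity
  have hbase : (n : ℝ) ^ 2 * c < (k / Real.exp 1) ^ 4 := by
    have hs : √(n : ℝ) ^ 4 = n ^ 2 := by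
      rw [show √(n : ℝ) ^ 4 = (√n ^ 2) ^ 2 by ring, Real.sq_sqrt (Nat.cast_nonneg n)]
    have h₁ : ((c + 1) * √(n : ℝ)) ^ 4 ≤ (k / Real.exp 1) ^ 4 := by gcongr
    rw [mul_pow, hs] at h₁
    rcases Nat.eq_zero_or_pos n with rfl | hn
    · simpa using pow_pos hkpos 4
    · refine lt_of_lt_of_le ?_ h₁
      have hn' : (0 : ℝ) < n ^ 2 := by positivity
      have hc : (c : ℝ) < (c + 1) ^ 4 := by
        have : (0 : ℝ) ≤ c := Nat.cast_nonneg c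
        nlinarith [pow_nonneg this 2, pow_nonneg this 3, pow_nonneg this 4]
      nlinarith
  have hchoose : (k ! : ℝ) * n.choose k ≤ n ^ k := by
    rw [← Nat.cast_mul, ← Nat.descFactorial_eq_factorial_mul_choose]
    exact_mod_cast Nat.descFactorial_le_pow n k
  have hmain : ((k ! : ℝ) * n.choose k) ^ 2 * c ^ k < (k ! : ℝ) ^ 2 * (k ! : ℝ) ^ 2 := by
    calc ((k ! : ℝ) * n.choose k) ^ 2 * c ^ k ≤ ((n : ℝ) ^ k) ^ 2 * c ^ k := by gcongr
      _ = ((n : ℝ) ^ 2 * c) ^ k := by rw [mul_pow, pow_right_comm]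
      _ < ((k / Real.exp 1) ^ 4) ^ k := by
          exact pow_lt_pow_left₀ hbase (by positivity) hk.ne'
      _ = ((k / Real.exp 1) ^ k) ^ 4 := pow_right_comm _ _ _
      _ ≤ (k ! : ℝ) ^ 4 := by gcongr
      _ = _ := by ring
  have : (n.choose k : ℝ) ^ 2 * c ^ k < (k ! : ℝ) ^ 2 := by
    rw [mul_pow, mul_assoc] at hmain
    exact lt_of_mul_lt_mul_left hmain (by positivity)
  exact_mod_cast this

theorem exists_forall_exists_not_hasAvoidingTwins {m : ℕ} (hm : 2 ≤ m)
    (τ : Equiv.Perm (Fin m)) :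
    ∃ C : ℝ, 0 < C ∧ ∀ n : ℕ, 1 ≤ n → ∃ π : Equiv.Perm (Fin n),
      ¬ HasAvoidingTwins π τ ⌈C * √n⌉₊ := by
  classical
  obtain ⟨c, hc⟩ := exists_card_avoidsPattern_le hm τ
  refine ⟨Real.exp 1 * (c + 1), by positivity, fun n hn => ?_⟩
  by_contra! hall
  set k := ⌈Real.exp 1 * (c + 1) * √n⌉₊ with hk
  have hkpos : 0 < k := Nat.ceil_pos.2 (by positivity)
  have hlt := choose_sq_mul_pow_lt_factorial_sq (n := n) hkpos (Nat.le_ceil _)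
  have hle := factorial_sq_mul_card_hasAvoidingTwins_le (k := k) (n := n) τ
  rw [filter_true_of_mem fun π _ => hall π, card_univ, Fintype.card_perm, Fintype.card_fin] at hle
  have hle' := Nat.le_of_mul_le_mul_right hle (Nat.factorial_pos n)
  exact (hlt.trans_le hle').not_ge (Nat.mul_le_mul_left _ (by convert hc k))

end Counting

/-- For a non-monotone pattern $τ$, $t(n, τ) = Θ(√n)$:
(i) every permutation of $[n]$ ($n ≥ 1$) contains τ-avoiding twins of length $⌊√n/2⌋$;
(ii) there is $C > 0$ such that for every $n ≥ 1$ some permutation of $[n]$ has no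
τ-avoiding twins of length $⌈C√n⌉$. -/
theorem avoiding_twins_theta (m : ℕ) (τ : Equiv.Perm (Fin m))
    (hmono : ¬ Monotone ⇑τ) (hanti : ¬ Antitone ⇑τ) :
    (∀ n : ℕ, 1 ≤ n → ∀ π : Equiv.Perm (Fin n),
        HasAvoidingTwins π τ (Nat.sqrt n / 2)) ∧
    ∃ C : ℝ, 0 < C ∧ ∀ n : ℕ, 1 ≤ n → ∃ π : Equiv.Perm (Fin n),
        ¬ HasAvoidingTwins π τ ⌈C * Real.sqrt n⌉₊ := by
  have hm : 2 ≤ m := by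
    by_contra h
    have : Subsingleton (Fin m) := Fin.subsingleton_iff_le_one.2 (by omega)
    exact hmono fun a b _ => (Subsingleton.elim _ _).le
  exact ⟨fun n hn π => hasAvoidingTwins_sqrt_div_two hmono hanti hn π,
    exists_forall_exists_not_hasAvoidingTwins hm τ⟩
end
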